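/- Let τ > √6, let 0 < β < 1/6, and let ρ_min be a minimizing measure with support M. Let γ : (−δ, δ) → S² be a smooth curve parametrized by arc length with γ(0) = p = (1,0,0) and γ'(0) = (0,1,0), and assume that p is a uniform two-sided accumulation point on γ of scaling β. Then at least one of the points q₁ = (cos θ_max, 0, sin θ_max) or q₂ = (cos θ_max, 0, −sin θ_max) is an accumulation point of M. -/

import Mathlib

open MeasureTheory Set
open scoped RealInnerProductSpace ENNReal

noncomputable section

/-- Euclidean three-space. -/
abbrev E3 := EuclideanSpace ℝ (Fin 3)

/-- The unit sphere `S² ⊂ ℝ³`. -/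
def Sphere2 : Set E3 := Metric.sphere 0 1

/-- The function `D(x,y) = (1/4)(1+⟨x,y⟩)(2 − τ²(1−⟨x,y⟩))`. -/
def Dfun (τ : ℝ) (x y : E3) : ℝ :=
  (1 / 4) * (1 + ⟪x, y⟫) * (2 - τ ^ 2 * (1 - ⟪x, y⟫))

/-- The Lagrangian `L = max(0, D)`. -/
def Lfun (τ : ℝ) (x y : E3) : ℝ := max 0 (Dfun τ x y)

/-- The causal action of a measure. -/
def causalAction (τ : ℝ) (ρ : Measure E3) : ℝ :=
  ∫ x, ∫ y, Lfun τ x y ∂ρ ∂ρ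

/-- `ρ` is a minimizing measure: a regular Borel probability measure supported on `S²`
minimizing the causal action among all such measures. -/
def IsMinimizer (τ : ℝ) (ρ : Measure E3) : Prop :=
  IsProbabilityMeasure ρ ∧ ρ.Regular ∧ ρ Sphere2ᶜ = 0 ∧
    ∀ ρ' : Measure E3, IsProbabilityMeasure ρ' → ρ'.Regular → ρ' Sphere2ᶜ = 0 →
      causalAction τ ρ ≤ causalAction τ ρ'

/-- The support of a measure. -/
def msupport (ρ : Measure E3) : Set E3 :=
  {x | ∀ U : Set E3, IsOpen U → x ∈ U → 0 < ρ U}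

/-- The opening angle `θ_max = arccos(1 − 2/τ²)`. -/
def θmax (τ : ℝ) : ℝ := Real.arccos (1 - 2 / τ ^ 2)

/-- The open light cone `I(p)`. -/
def lightConeI (τ : ℝ) (p : E3) : Set E3 := {q ∈ Sphere2 | 0 < Dfun τ p q}

/-- The boundary of the light cone `K(p)`. -/
def lightConeK (τ : ℝ) (p : E3) : Set E3 :=
  {q ∈ Sphere2 | ⟪p, q⟫ = Real.cos (θmax τ)}

/-- Make a point of `ℝ³` from coordinates. -/
def mkE3 (a b c : ℝ) : E3 := (WithLp.equiv 2 (Fin 3 → ℝ)).symm ![a, b, c]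

/-- A totally timelike set. -/
def TotallyTimelike (τ : ℝ) (Ω : Set E3) : Prop := ∀ x ∈ Ω, ∀ y ∈ Ω, 0 < Dfun τ x y

/-- `p` is an accumulation point of `A`: every neighborhood of `p` contains a point
of `A` different from `p`. -/
def AccumulationPt (p : E3) (A : Set E3) : Prop :=
  ∀ U ∈ nhds p, ∃ x ∈ A, x ∈ U ∧ x ≠ p

/-- `γ(0)` is a uniform two-sided accumulation point (of points of `M`) on `γ` of
scaling `β`, where `γ` is defined on `(−δ, δ)`. -/
def UniformTwoSidedAcc (M : Set E3) (β δ : ℝ) (γ : ℝ → E3) : Prop :=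
  ∃ ε₀ : ℝ, 0 < ε₀ ∧ ε₀ < δ ∧ ∀ ε : ℝ, 0 < ε → ε ≤ ε₀ →
    (∃ t ∈ Set.Ioo (-ε) (-(ε ^ (1 + β))), γ t ∈ M) ∧
    (∃ t ∈ Set.Ioo (ε ^ (1 + β)) ε, γ t ∈ M)

/-- The point `q₁ = (cos θ_max, 0, sin θ_max)`. -/
def q1pt (τ : ℝ) : E3 := mkE3 (Real.cos (θmax τ)) 0 (Real.sin (θmax τ))

/-- The point `q₂ = (cos θ_max, 0, −sin θ_max)`. -/
def q2pt (τ : ℝ) : E3 := mkE3 (Real.cos (θmax τ)) 0 (-Real.sin (θmax τ))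

/-- The curve `p_s = (cos s, sin s, 0)` along the equator. -/
def pcurve (s : ℝ) : E3 := mkE3 (Real.cos s) (Real.sin s) 0

/-- Geodesic ball in `S²` of radius `r` around `q`. -/
def geoBall (q : E3) (r : ℝ) : Set E3 := {x ∈ Sphere2 | Real.arccos ⟪q, x⟫ < r}

/-- The set `U_r = (B_r(q₁) ∪ B_r(q₂)) ∖ {q₁, q₂}`. -/
def Uset (τ r : ℝ) : Set E3 := (geoBall (q1pt τ) r ∪ geoBall (q2pt τ) r) \ {q1pt τ, q2pt τ}

/-- The set `I_r(q) = I(q) ∖ U_r`. -/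
def Iset (τ r : ℝ) (q : E3) : Set E3 := lightConeI τ q \ Uset τ r

/-- The point of `S²` with latitude `θ` (measured from the equator) and longitude `φ`. -/
def sphPt (θ φ : ℝ) : E3 :=
  mkE3 (Real.cos θ * Real.cos φ) (Real.cos θ * Real.sin φ) (Real.sin θ)

/-- The restrictions to `Ω` of polynomials of degree at most two on `ℝ³`. -/
def polyRestrictSet (Ω : Set E3) : Set (Ω → ℝ) :=
  {f | ∃ P : MvPolynomial (Fin 3) ℝ, P.totalDegree ≤ 2 ∧
        ∀ x : Ω, f x = MvPolynomial.eval (fun i => (x : E3) i) P}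

/-- The space `K(Ω)` of restrictions to `Ω` of polynomials of degree at most two. -/
def KSpace (Ω : Set E3) : Submodule ℝ (Ω → ℝ) := Submodule.span ℝ (polyRestrictSet Ω)

/-- Two-dimensional Hausdorff (surface) measure on `S²` restricted to `Ω`, as a
measure on `Ω`. -/
def surfΩ (Ω : Set E3) : Measure Ω := Measure.comap Subtype.val (μH[2] : Measure E3)

/-- The bilinear form `B(f,g) = ∫_Ω ∫_Ω D(x,y) f(x) g(y) dμ(x) dμ(y)` on functions on `Ω`. -/
def Bform (τ : ℝ) (Ω : Set E3) (f g : Ω → ℝ) : ℝ :=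
  ∫ x, ∫ y, Dfun τ (x : E3) (y : E3) * f x * g y ∂(surfΩ Ω) ∂(surfΩ Ω)

end

section abstractPart

variable {k : E3 → E3 → ℝ} {ρ : Measure E3}

lemma int_k [IsFiniteMeasure ρ] (hc : Continuous (Function.uncurry k)) (h0 : ∀ x y, 0 ≤ k x y)
    (h1 : ∀ x y, k x y ≤ 1) (x : E3) : Integrable (k x) ρ := by
  apply Integrable.of_bound (C := 1)
  · exact (hc.comp (Continuous.prodMk_right x)).aestronglyMeasurable
  · filter_upwards with y
    rw [Real.norm_eq_abs, abs_of_nonneg (h0 x y)]; exact h1 x y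

lemma cont_l [IsFiniteMeasure ρ] (hc : Continuous (Function.uncurry k)) (h0 : ∀ x y, 0 ≤ k x y)
    (h1 : ∀ x y, k x y ≤ 1) : Continuous (fun x => ∫ y, k x y ∂ρ) := by
  apply continuous_of_dominated (bound := fun _ => 1)
  · intro x; exact (int_k hc h0 h1 x).aestronglyMeasurable
  · intro x; filter_upwards with y
    rw [Real.norm_eq_abs, abs_of_nonneg (h0 x y)]; exact h1 x y
  · exact integrable_const _
  · filter_upwards with y
    exact hc.comp (Continuous.prodMk_left y)

lemma bnd_l [IsProbabilityMeasure ρ] (hc : Continuous (Function.uncurry k)) (h0 : ∀ x y, 0 ≤ k x y)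
    (h1 : ∀ x y, k x y ≤ 1) (x : E3) : |∫ y, k x y ∂ρ| ≤ 1 := by
  rw [abs_of_nonneg (integral_nonneg (h0 x))]
  calc ∫ y, k x y ∂ρ ≤ ∫ y, (1:ℝ) ∂ρ :=
        integral_mono (int_k hc h0 h1 x) (integrable_const _) (h1 x)
    _ = 1 := by simp

lemma int_l {σ : Measure E3} [IsFiniteMeasure σ] [IsProbabilityMeasure ρ]
    (hc : Continuous (Function.uncurry k)) (h0 : ∀ x y, 0 ≤ k x y)
    (h1 : ∀ x y, k x y ≤ 1) : Integrable (fun x => ∫ y, k x y ∂ρ) σ := by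
  apply Integrable.of_bound (C := 1)
  · exact (cont_l hc h0 h1).aestronglyMeasurable
  · filter_upwards with y
    exact bnd_l hc h0 h1 y

lemma EL1 [IsProbabilityMeasure ρ]
    (hc : Continuous (Function.uncurry k)) (h0 : ∀ x y, 0 ≤ k x y)
    (h1 : ∀ x y, k x y ≤ 1) (hs : ∀ x y, k x y = k y x) (hρ : ρ Sphere2ᶜ = 0)
    (hm : ∀ σ : Measure E3, IsProbabilityMeasure σ → σ Sphere2ᶜ = 0 →
      ∫ x, ∫ y, k x y ∂ρ ∂ρ ≤ ∫ x, ∫ y, k x y ∂σ ∂σ) (x : E3) (hx : x ∈ Sphere2) :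
    ∫ x, ∫ y, k x y ∂ρ ∂ρ ≤ ∫ y, k x y ∂ρ := by
  set S := ∫ x, ∫ y, k x y ∂ρ ∂ρ with hS
  set l := ∫ y, k x y ∂ρ with hl
  have key : ∀ e : ℝ, 0 < e → e ≤ 1 →
      S ≤ (1-e)^2 * S + 2*e*(1-e)*l + e^2 * k x x := by
    intro e he he1
    have h1e : 0 ≤ 1 - e := by linarith
    let σ : Measure E3 := ENNReal.ofReal (1-e) • ρ + ENNReal.ofReal e • Measure.dirac x
    have hσp : IsProbabilityMeasure σ := by
      constructor
      simp only [σ, Measure.add_apply, Measure.smul_apply, measure_univ, smul_eq_mul, mul_one]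
      rw [← ENNReal.ofReal_add h1e he.le]; simp
    have hσs : σ Sphere2ᶜ = 0 := by
      simp only [σ, Measure.add_apply, Measure.smul_apply, hρ, smul_eq_mul, mul_zero, zero_add]
      have hms : MeasurableSet Sphere2ᶜ := by
        unfold Sphere2; exact Metric.isClosed_sphere.measurableSet.compl
      rw [Measure.dirac_apply' _ hms]
      simp [hx]
    have := hm σ hσp hσs
    have inn : ∀ z, ∫ y, k z y ∂σ = (1-e) * ∫ y, k z y ∂ρ + e * k z x := by
      intro z
      rw [integral_add_measure ((int_k hc h0 h1 z).smul_measure ENNReal.ofReal_ne_top)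
        ((int_k hc h0 h1 z).smul_measure ENNReal.ofReal_ne_top), integral_smul_measure,
        integral_smul_measure, integral_dirac, ENNReal.toReal_ofReal h1e,
        ENNReal.toReal_ofReal he.le]
      simp
    simp_rw [inn] at this
    have i1 : ∀ ν : Measure E3, IsProbabilityMeasure ν →
        Integrable (fun z => (1-e) * ∫ y, k z y ∂ρ + e * k z x) ν := by
      intro ν hν
      refine ((int_l hc h0 h1).const_mul _).add (Integrable.const_mul ?_ _)
      simp_rw [fun z => hs z x]
      exact int_k hc h0 h1 x
    rw [integral_add_measure ((i1 ρ inferInstance).smul_measure ENNReal.ofReal_ne_top)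
        ((i1 _ inferInstance).smul_measure ENNReal.ofReal_ne_top), integral_smul_measure,
        integral_smul_measure, integral_dirac, ENNReal.toReal_ofReal h1e,
        ENNReal.toReal_ofReal he.le, integral_add ((int_l hc h0 h1).const_mul _), 
        integral_const_mul, integral_const_mul] at this
    · simp_rw [fun z => hs z x] at this
      simp only [smul_eq_mul] at this
      rw [← hl, ← hS] at this
      linarith
    · refine (Integrable.const_mul ?_ _)
      simp_rw [fun z => hs z x]
      exact int_k hc h0 h1 x
  by_contra hlt
  push Not at hlt
  have hk := h1 x x
  have hk0 := h0 x x
  have hl0 : 0 ≤ l := integral_nonneg (h0 x)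
  have hS1 : S ≤ 1 := by
    have : S ≤ ∫ x, (1:ℝ) ∂ρ := integral_mono (int_l hc h0 h1) (integrable_const _)
      (fun x => (abs_le.1 (bnd_l hc h0 h1 x)).2)
    simpa using this
  -- e = (S - l)/2
  have := key ((S-l)/2) (by linarith) (by linarith)
  nlinarith [mul_pos (sub_pos.2 hlt) (sub_pos.2 hlt), mul_nonneg (sq_nonneg (S-l)) (sub_nonneg.2 hk), mul_pos (mul_pos (sub_pos.2 hlt) (sub_pos.2 hlt)) (sub_pos.2 hlt), mul_nonneg (sq_nonneg (S-l)) (sub_nonneg.2 hS1), mul_nonneg (sq_nonneg (S-l)) hl0]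

lemma EL_ae [IsProbabilityMeasure ρ]
    (hc : Continuous (Function.uncurry k)) (h0 : ∀ x y, 0 ≤ k x y)
    (h1 : ∀ x y, k x y ≤ 1) (hs : ∀ x y, k x y = k y x) (hρ : ρ Sphere2ᶜ = 0)
    (hm : ∀ σ : Measure E3, IsProbabilityMeasure σ → σ Sphere2ᶜ = 0 →
      ∫ x, ∫ y, k x y ∂ρ ∂ρ ≤ ∫ x, ∫ y, k x y ∂σ ∂σ) :
    ∀ᵐ x ∂ρ, ∫ y, k x y ∂ρ = ∫ x, ∫ y, k x y ∂ρ ∂ρ := by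
  have hsph : ∀ᵐ x ∂ρ, x ∈ Sphere2 := by rw [ae_iff]; exact hρ
  set S := ∫ x, ∫ y, k x y ∂ρ ∂ρ with hS
  have hnn : 0 ≤ᵐ[ρ] fun x => (∫ y, k x y ∂ρ) - S := by
    filter_upwards [hsph] with x hx
    exact sub_nonneg.2 (EL1 hc h0 h1 hs hρ hm x hx)
  have := (integral_eq_zero_iff_of_nonneg_ae hnn ((int_l hc h0 h1).sub (integrable_const _))).1 (by
    rw [integral_sub (int_l hc h0 h1) (integrable_const _)]; simp [hS])
  filter_upwards [this] with x hx
  simp at hx; linarith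

lemma EL2 [IsProbabilityMeasure ρ]
    (hc : Continuous (Function.uncurry k)) (h0 : ∀ x y, 0 ≤ k x y)
    (h1 : ∀ x y, k x y ≤ 1) (hs : ∀ x y, k x y = k y x) (hρ : ρ Sphere2ᶜ = 0)
    (hm : ∀ σ : Measure E3, IsProbabilityMeasure σ → σ Sphere2ᶜ = 0 →
      ∫ x, ∫ y, k x y ∂ρ ∂ρ ≤ ∫ x, ∫ y, k x y ∂σ ∂σ) (x : E3) (hx : x ∈ msupport ρ) :
    ∫ y, k x y ∂ρ = ∫ x, ∫ y, k x y ∂ρ ∂ρ := by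
  by_contra hne
  have hae := EL_ae hc h0 h1 hs hρ hm
  set S := ∫ x, ∫ y, k x y ∂ρ ∂ρ with hS
  have ho : IsOpen {x | ∫ y, k x y ∂ρ ≠ S} := isOpen_ne_fun (cont_l hc h0 h1) continuous_const
  have := hx _ ho hne
  rw [ae_iff] at hae
  exact this.ne' hae

lemma psd_fun [IsProbabilityMeasure ρ]
    (hc : Continuous (Function.uncurry k)) (h0 : ∀ x y, 0 ≤ k x y)
    (h1 : ∀ x y, k x y ≤ 1) (hs : ∀ x y, k x y = k y x) (hρ : ρ Sphere2ᶜ = 0)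
    (hm : ∀ σ : Measure E3, IsProbabilityMeasure σ → σ Sphere2ᶜ = 0 →
      ∫ x, ∫ y, k x y ∂ρ ∂ρ ≤ ∫ x, ∫ y, k x y ∂σ ∂σ) (f : E3 → ℝ) (hf : Measurable f)
    (C : ℝ) (hC : ∀ x, |f x| ≤ C) : 0 ≤ ∫ x, f x * ∫ y, f y * k x y ∂ρ ∂ρ := by
  have hae := EL_ae hc h0 h1 hs hρ hm
  set S := ∫ x, ∫ y, k x y ∂ρ ∂ρ with hS
  have hS0 : 0 ≤ S := integral_nonneg (fun x => integral_nonneg (h0 x))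
  have hC0 : 0 ≤ C := (abs_nonneg _).trans (hC 0)
  have habs : ∀ x y, |k x y| ≤ 1 := fun x y => by rw [abs_of_nonneg (h0 x y)]; exact h1 x y
  have hkm : Measurable (Function.uncurry k) := hc.measurable
  have hfi : Integrable f ρ := Integrable.of_bound hf.aestronglyMeasurable C
    (Filter.Eventually.of_forall hC)
  set c := ∫ x, f x ∂ρ with hcdef
  have hcC : |c| ≤ C := by
    have := norm_integral_le_of_norm_le_const (μ := ρ) (f := f) (C := C)
      (Filter.Eventually.of_forall hC)
    simpa using this
  have hfk : ∀ x, Integrable (fun y => f y * k x y) ρ := by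
    intro x
    refine Integrable.of_bound (hf.mul (hkm.comp measurable_prodMk_left)).aestronglyMeasurable C
      (Filter.Eventually.of_forall fun y => ?_)
    rw [Real.norm_eq_abs, abs_mul]
    nlinarith [hC y, habs x y, abs_nonneg (f y), abs_nonneg (k x y)]
  have hfkb : ∀ x, |∫ y, f y * k x y ∂ρ| ≤ C := by
    intro x
    have := norm_integral_le_of_norm_le_const (μ := ρ) (f := fun y => f y * k x y) (C := C)
      (Filter.Eventually.of_forall fun y => by
        rw [Real.norm_eq_abs, abs_mul]
        nlinarith [hC y, habs x y, abs_nonneg (f y), abs_nonneg (k x y)])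
    simpa using this
  have hfkm : Measurable (fun x => ∫ y, f y * k x y ∂ρ) := by
    have : StronglyMeasurable (fun p : E3 × E3 => f p.2 * k p.1 p.2) :=
      ((hf.comp measurable_snd).mul hkm).stronglyMeasurable
    exact this.integral_prod_right.measurable
  have hI1 : Integrable (fun x => ∫ y, f y * k x y ∂ρ) ρ :=
    Integrable.of_bound hfkm.aestronglyMeasurable C (Filter.Eventually.of_forall hfkb)
  have hI2 : Integrable (fun x => f x * ∫ y, f y * k x y ∂ρ) ρ := by
    refine Integrable.of_bound (hf.mul hfkm).aestronglyMeasurable (C*C)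
      (Filter.Eventually.of_forall fun x => ?_)
    rw [Real.norm_eq_abs, abs_mul]
    exact mul_le_mul (hC x) (hfkb x) (abs_nonneg _) hC0
  have hI3 : Integrable (fun x => f x * ∫ y, k x y ∂ρ) ρ := by
    refine Integrable.of_bound (hf.mul (cont_l hc h0 h1).measurable).aestronglyMeasurable (C*1)
      (Filter.Eventually.of_forall fun x => ?_)
    rw [Real.norm_eq_abs, abs_mul]
    exact mul_le_mul (hC x) (bnd_l hc h0 h1 x) (abs_nonneg _) hC0
  have e3 : ∫ x, f x * ∫ y, k x y ∂ρ ∂ρ = c * S := by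
    rw [hcdef, ← integral_mul_const]
    apply integral_congr_ae
    filter_upwards [hae] with x hx
    rw [hx]
  have e1 : ∫ x, ∫ y, f y * k x y ∂ρ ∂ρ = c * S := by
    rw [integral_integral_swap]
    · rw [← e3]
      congr 1; ext x
      rw [integral_const_mul]
      simp_rw [fun z => hs z x]
    · refine Integrable.of_bound ((hf.comp measurable_snd).mul hkm).aestronglyMeasurable C
        (Filter.Eventually.of_forall fun p => ?_)
      rw [Real.norm_eq_abs]
      change |f p.2 * k p.1 p.2| ≤ C
      rw [abs_mul]
      nlinarith [hC p.2, habs p.1 p.2, abs_nonneg (f p.2), abs_nonneg (k p.1 p.2)]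
  set Q := ∫ x, f x * ∫ y, f y * k x y ∂ρ ∂ρ with hQ
  obtain ⟨e, he, hee⟩ : ∃ e : ℝ, 0 < e ∧ e * (2 * C) ≤ 1 := by
    refine ⟨1/(2*C+1), by positivity, ?_⟩
    rw [div_mul_eq_mul_div, div_le_one (by positivity)]; linarith
  set α := 1 - e * c with hα
  have hg0 : ∀ x, 0 ≤ α + e * f x := by
    intro x
    have h2 := abs_le.1 (hC x)
    have h3 := abs_le.1 hcC
    rw [hα]
    nlinarith
  have hgm : Measurable (fun x => α + e * f x) := measurable_const.add (hf.const_mul e)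
  have hgi : Integrable (fun x => α + e * f x) ρ := (integrable_const _).add (hfi.const_mul e)
  let σ : Measure E3 := ρ.withDensity (fun x => ENNReal.ofReal (α + e * f x))
  have hσi : ∀ F : E3 → ℝ, ∫ x, F x ∂σ = ∫ x, (α + e * f x) * F x ∂ρ := by
    intro F
    rw [integral_withDensity_eq_integral_toReal_smul hgm.ennreal_ofReal
      (Filter.Eventually.of_forall fun x => ENNReal.ofReal_lt_top)]
    simp_rw [ENNReal.toReal_ofReal (hg0 _), smul_eq_mul]
  have hσp : IsProbabilityMeasure σ := by
    constructor
    rw [withDensity_apply _ MeasurableSet.univ, Measure.restrict_univ,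
      ← ofReal_integral_eq_lintegral_ofReal hgi (Filter.Eventually.of_forall hg0),
      integral_add (integrable_const _) (hfi.const_mul e), integral_const_mul, ← hcdef, hα]
    simp
  have hσs : σ Sphere2ᶜ = 0 := withDensity_absolutelyContinuous _ _ hρ
  have := hm σ hσp hσs
  have inn : ∀ x, ∫ y, k x y ∂σ = α * ∫ y, k x y ∂ρ + e * ∫ y, f y * k x y ∂ρ := by
    intro x
    rw [hσi, ← integral_const_mul, ← integral_const_mul, ← integral_add]
    · congr 1; ext y; ring
    · exact (int_k hc h0 h1 x).const_mul _
    · exact (hfk x).const_mul _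
  simp_rw [inn] at this
  rw [hσi] at this
  have ex : ∫ x, (α + e * f x) * (α * ∫ y, k x y ∂ρ + e * ∫ y, f y * k x y ∂ρ) ∂ρ
      = α^2 * S + α * e * (∫ x, ∫ y, f y * k x y ∂ρ ∂ρ)
        + α * e * (∫ x, f x * ∫ y, k x y ∂ρ ∂ρ) + e^2 * Q := by
    rw [hQ, hS, ← integral_const_mul, ← integral_const_mul, ← integral_const_mul,
      ← integral_const_mul, ← integral_add, ← integral_add, ← integral_add]
    · congr 1; ext x; ring
    · exact (((int_l hc h0 h1).const_mul _).add (hI1.const_mul _)).add (hI3.const_mul _)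
    · exact hI2.const_mul _
    · exact ((int_l hc h0 h1).const_mul _).add (hI1.const_mul _)
    · exact hI3.const_mul _
    · exact (int_l hc h0 h1).const_mul _
    · exact hI1.const_mul _
  rw [ex, e1, e3] at this
  have h5 : 0 ≤ e^2 * (Q - c^2 * S) := by
    have : α^2 * S + α * e * (c*S) + α * e * (c * S) + e^2 * Q = S + e^2 * (Q - c^2*S) := by
      rw [hα]; ring
    linarith
  have h6 : 0 ≤ Q - c^2 * S := nonneg_of_mul_nonneg_right h5 (by positivity)
  nlinarith [mul_nonneg (sq_nonneg c) hS0]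

lemma psd_pts [IsProbabilityMeasure ρ]
    (hc : Continuous (Function.uncurry k)) (h0 : ∀ x y, 0 ≤ k x y)
    (h1 : ∀ x y, k x y ≤ 1) (hs : ∀ x y, k x y = k y x) (hρ : ρ Sphere2ᶜ = 0)
    (hm : ∀ σ : Measure E3, IsProbabilityMeasure σ → σ Sphere2ᶜ = 0 →
      ∫ x, ∫ y, k x y ∂ρ ∂ρ ≤ ∫ x, ∫ y, k x y ∂σ ∂σ) {n : ℕ} (w : Fin n → ℝ) (p : Fin n → E3)
    (hp : ∀ i, p i ∈ msupport ρ) : 0 ≤ ∑ i, ∑ j, w i * w j * k (p i) (p j) := by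
  refine le_of_forall_pos_le_add fun η hη => ?_
  set W := ∑ i, ∑ j, |w i * w j| with hW
  have hW0 : 0 ≤ W := Finset.sum_nonneg fun i _ => Finset.sum_nonneg fun j _ => abs_nonneg _
  obtain ⟨η', hη', hηW⟩ : ∃ η' : ℝ, 0 < η' ∧ η' * W ≤ η := by
    refine ⟨η/(W+1), by positivity, ?_⟩
    rw [div_mul_eq_mul_div, div_le_iff₀ (by positivity)]; nlinarith
  have hr : ∃ r > 0, ∀ i j, ∀ x ∈ Metric.ball (p i) r, ∀ y ∈ Metric.ball (p j) r,
      |k x y - k (p i) (p j)| ≤ η' := by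
    have : ∀ i j, ∀ᶠ r in nhdsWithin (0:ℝ) (Set.Ioi 0), ∀ x ∈ Metric.ball (p i) r, 
        ∀ y ∈ Metric.ball (p j) r, |k x y - k (p i) (p j)| ≤ η' := by
      intro i j
      obtain ⟨d, hd, h⟩ := Metric.continuousAt_iff.1 (hc.continuousAt (x := (p i, p j))) η' hη'
      filter_upwards [Ioo_mem_nhdsGT hd] with r hr x hx y hy
      have := h (x := (x, y)) (by
        rw [Prod.dist_eq]
        exact max_lt (lt_trans hx hr.2) (lt_trans hy hr.2))
      rw [Real.dist_eq] at this
      exact this.le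
    have h2 := (Filter.eventually_all.2 fun i => Filter.eventually_all.2 (this i)).and
      self_mem_nhdsWithin
    obtain ⟨r, hr, hr0⟩ := h2.exists
    exact ⟨r, hr0, hr⟩
  obtain ⟨r, hr0, hr⟩ := hr
  set B : Fin n → Set E3 := fun i => Metric.ball (p i) r with hB
  have hBm : ∀ i, MeasurableSet (B i) := fun i => measurableSet_ball
  have hBpos : ∀ i, 0 < ρ.real (B i) := by
    intro i
    rw [measureReal_def]
    exact ENNReal.toReal_pos (hp i _ Metric.isOpen_ball (Metric.mem_ball_self hr0)).ne'
      (measure_ne_top _ _)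
  set v : Fin n → ℝ := fun i => w i / ρ.real (B i) with hv
  set f : E3 → ℝ := fun x => ∑ i, v i * (B i).indicator 1 x with hf
  have hfm : Measurable f := by
    apply Finset.measurable_fun_sum
    intro i _
    exact (measurable_one.indicator (hBm i)).const_mul _
  have hfC : ∀ x, |f x| ≤ ∑ i, |v i| := by
    intro x
    refine (Finset.abs_sum_le_sum_abs _ _).trans (Finset.sum_le_sum fun i _ => ?_)
    rw [abs_mul]
    refine mul_le_of_le_one_right (abs_nonneg _) ?_
    by_cases h : x ∈ B i <;> simp [h]
  have hpsd := psd_fun hc h0 h1 hs hρ hm f hfm _ hfC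
  have hin : ∀ x, ∫ y, f y * k x y ∂ρ = ∑ j, v j * ∫ y in B j, k x y ∂ρ := by
    intro x
    have : (fun y => f y * k x y) = fun y => ∑ j, v j * (B j).indicator (k x) y := by
      ext y
      rw [hf, Finset.sum_mul]
      refine Finset.sum_congr rfl fun j _ => ?_
      by_cases h : y ∈ B j <;> simp [h]
    rw [this, integral_finsetSum]
    · refine Finset.sum_congr rfl fun j _ => ?_
      rw [integral_const_mul, integral_indicator (hBm j)]
    · intro j _
      exact ((int_k hc h0 h1 x).indicator (hBm j)).const_mul _
  have hilr : ∀ j, Continuous (fun x => ∫ y in B j, k x y ∂ρ) := fun j => cont_l hc h0 h1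
  have hilb : ∀ j x, |∫ y in B j, k x y ∂ρ| ≤ 1 := by
    intro j x
    rw [abs_of_nonneg (integral_nonneg (h0 x))]
    refine (setIntegral_le_integral (int_k hc h0 h1 x) 
      (Filter.Eventually.of_forall (h0 x))).trans ?_
    exact (abs_le.1 (bnd_l hc h0 h1 x)).2
  have hili : ∀ j, Integrable (fun x => ∫ y in B j, k x y ∂ρ) ρ := fun j =>
    Integrable.of_bound (hilr j).aestronglyMeasurable 1 (Filter.Eventually.of_forall (hilb j))
  have hout : ∫ x, f x * ∫ y, f y * k x y ∂ρ ∂ρ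
      = ∑ i, ∑ j, v i * v j * ∫ x in B i, ∫ y in B j, k x y ∂ρ ∂ρ := by
    simp_rw [hin]
    have : (fun x => f x * ∑ j, v j * ∫ y in B j, k x y ∂ρ) = fun x =>
        ∑ i, ∑ j, v i * v j * (B i).indicator (fun x => ∫ y in B j, k x y ∂ρ) x := by
      ext x
      rw [hf, Finset.sum_mul]
      refine Finset.sum_congr rfl fun i _ => ?_
      rw [Finset.mul_sum]
      refine Finset.sum_congr rfl fun j _ => ?_
      by_cases h : x ∈ B i <;> simp [h]
      ring
    rw [this, integral_finsetSum]
    · refine Finset.sum_congr rfl fun i _ => ?_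
      rw [integral_finsetSum]
      · refine Finset.sum_congr rfl fun j _ => ?_
        rw [integral_const_mul, integral_indicator (hBm i)]
      · intro j _
        exact ((hili j).indicator (hBm i)).const_mul _
    · intro i _
      refine integrable_finsetSum _ fun j _ => ?_
      exact ((hili j).indicator (hBm i)).const_mul _
  rw [hout] at hpsd
  have hterm : ∀ i j, v i * v j * ∫ x in B i, ∫ y in B j, k x y ∂ρ ∂ρ
      ≤ w i * w j * k (p i) (p j) + |w i * w j| * η' := by
    intro i j
    have hd : |(∫ x in B i, ∫ y in B j, k x y ∂ρ ∂ρ) - ρ.real (B i) * ρ.real (B j) * k (p i) (p j)|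
        ≤ η' * ρ.real (B j) * ρ.real (B i) := by
      have e1 : ∀ x ∈ B i, |(∫ y in B j, k x y ∂ρ) - ρ.real (B j) * k (p i) (p j)|
          ≤ η' * ρ.real (B j) := by
        intro x hx
        have : (∫ y in B j, k x y ∂ρ) - ρ.real (B j) * k (p i) (p j)
            = ∫ y in B j, (k x y - k (p i) (p j)) ∂ρ := by
          rw [integral_sub (int_k hc h0 h1 x) (integrable_const _)]
          simp
        rw [this]
        rw [← Real.norm_eq_abs]
        exact norm_setIntegral_le_of_norm_le_const (measure_lt_top _ _)
          (fun y hy => by rw [Real.norm_eq_abs]; exact hr i j x hx y hy)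
      have : (∫ x in B i, ∫ y in B j, k x y ∂ρ ∂ρ) - ρ.real (B i) * ρ.real (B j) * k (p i) (p j)
          = ∫ x in B i, ((∫ y in B j, k x y ∂ρ) - ρ.real (B j) * k (p i) (p j)) ∂ρ := by
        rw [integral_sub (hili j).integrableOn (integrable_const _)]
        simp; ring
      rw [this]
      rw [← Real.norm_eq_abs]
      exact norm_setIntegral_le_of_norm_le_const (measure_lt_top _ _)
        (fun x hx => by rw [Real.norm_eq_abs]; exact e1 x hx)
    have hi := hBpos i
    have hj := hBpos j
    set J := ∫ x in B i, ∫ y in B j, k x y ∂ρ ∂ρ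
    have hvv : v i * v j = w i * w j / (ρ.real (B i) * ρ.real (B j)) := by
      rw [hv]; field_simp
    have : v i * v j * J - w i * w j * k (p i) (p j) =
        (w i * w j) * ((J - ρ.real (B i) * ρ.real (B j) * k (p i) (p j)) 
          / (ρ.real (B i) * ρ.real (B j))) := by
      rw [hvv]; field_simp
    have h2 : |v i * v j * J - w i * w j * k (p i) (p j)| ≤ |w i * w j| * η' := by
      rw [this, abs_mul]
      refine mul_le_mul_of_nonneg_left ?_ (abs_nonneg _)
      rw [abs_div, abs_of_pos (mul_pos hi hj), div_le_iff₀ (mul_pos hi hj)]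
      linarith
    linarith [(abs_le.1 h2).2]
  calc (0:ℝ) ≤ _ := hpsd
    _ ≤ ∑ i, ∑ j, (w i * w j * k (p i) (p j) + |w i * w j| * η') :=
        Finset.sum_le_sum fun i _ => Finset.sum_le_sum fun j _ => hterm i j
    _ = (∑ i, ∑ j, w i * w j * k (p i) (p j)) + η' * W := by
        simp_rw [Finset.sum_add_distrib, hW, ← Finset.sum_mul]; ring
    _ ≤ _ := by linarith

end abstractPart

noncomputable def kf (τ : ℝ) (x y : E3) : ℝ := min 1 (Lfun τ x y)

lemma Lfun_cont (τ : ℝ) : Continuous (Function.uncurry (Lfun τ)) := by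
  unfold Lfun Dfun Function.uncurry
  fun_prop

lemma kf_cont (τ : ℝ) : Continuous (Function.uncurry (kf τ)) :=
  continuous_const.min (Lfun_cont τ)

lemma kf_nonneg (τ : ℝ) (x y : E3) : 0 ≤ kf τ x y := le_min zero_le_one (le_max_left _ _)

lemma kf_le (τ : ℝ) (x y : E3) : kf τ x y ≤ 1 := min_le_left _ _

lemma kf_symm (τ : ℝ) (x y : E3) : kf τ x y = kf τ y x := by
  unfold kf Lfun Dfun
  rw [real_inner_comm]

lemma inner_bd {x y : E3} (hx : x ∈ Sphere2) (hy : y ∈ Sphere2) :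
    -1 ≤ ⟪x, y⟫ ∧ ⟪x, y⟫ ≤ 1 := by
  have hx' : ‖x‖ = 1 := by simpa [Sphere2] using hx
  have hy' : ‖y‖ = 1 := by simpa [Sphere2] using hy
  have := abs_real_inner_le_norm x y
  rw [hx', hy', one_mul] at this
  exact abs_le.1 this

lemma kf_eq (τ : ℝ) {x y : E3} (hx : x ∈ Sphere2) (hy : y ∈ Sphere2) :
    kf τ x y = Lfun τ x y := by
  apply min_eq_right
  obtain ⟨h1, h2⟩ := inner_bd hx hy
  apply max_le zero_le_one
  unfold Dfun
  have h3 : 0 ≤ τ^2 * (1 - ⟪x, y⟫) := mul_nonneg (sq_nonneg _) (by linarith)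
  have h4 : 0 ≤ (1 + ⟪x, y⟫) * (τ^2 * (1 - ⟪x, y⟫)) := mul_nonneg (by linarith) h3
  nlinarith

lemma action_eq (τ : ℝ) {ρ : Measure E3} (hρ : ρ Sphere2ᶜ = 0) :
    causalAction τ ρ = ∫ x, ∫ y, kf τ x y ∂ρ ∂ρ := by
  have hsph : ∀ᵐ x ∂ρ, x ∈ Sphere2 := by rw [ae_iff]; exact hρ
  apply integral_congr_ae
  filter_upwards [hsph] with x hx
  apply integral_congr_ae
  filter_upwards [hsph] with y hy
  exact (kf_eq τ hx hy).symm

lemma min_kf {τ : ℝ} {ρ : Measure E3} (h : IsMinimizer τ ρ) :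
    ∀ σ : Measure E3, IsProbabilityMeasure σ → σ Sphere2ᶜ = 0 →
      ∫ x, ∫ y, kf τ x y ∂ρ ∂ρ ≤ ∫ x, ∫ y, kf τ x y ∂σ ∂σ := by
  intro σ hσ hs
  rw [← action_eq τ h.2.2.1, ← action_eq τ hs]
  exact h.2.2.2 σ hσ inferInstance hs

lemma msupp_sphere {ρ : Measure E3} (hρ : ρ Sphere2ᶜ = 0) : msupport ρ ⊆ Sphere2 := by
  intro x hx
  by_contra hn
  have ho : IsOpen Sphere2ᶜ := by unfold Sphere2; exact Metric.isClosed_sphere.isOpen_compl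
  exact (hx _ ho hn).ne' hρ

lemma msupp_closed (ρ : Measure E3) : IsClosed (msupport ρ) := by
  rw [← isOpen_compl_iff, isOpen_iff_forall_mem_open]
  intro x hx
  simp only [msupport, mem_compl_iff, mem_ofPred_eq, not_forall] at hx
  obtain ⟨U, hU, hxU, h⟩ := hx
  exact ⟨U, fun y hy hy' => h (hy' U hU hy), hU, hxU⟩

lemma msupp_ae (ρ : Measure E3) : ∀ᵐ x ∂ρ, x ∈ msupport ρ := by
  rw [ae_iff]
  apply measure_null_of_locally_null
  intro x hx
  simp only [msupport, mem_ofPred_eq, not_forall] at hx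
  obtain ⟨U, hU, hxU, h⟩ := hx
  exact ⟨U, mem_nhdsWithin_of_mem_nhds (hU.mem_nhds hxU), by simpa using h⟩

lemma inner_mk (a b c : ℝ) (y : E3) : ⟪mkE3 a b c, y⟫ = a * y 0 + b * y 1 + c * y 2 := by
  simp [mkE3, PiLp.inner_apply, Fin.sum_univ_three]
  ring

lemma sph_coord {y : E3} (hy : y ∈ Sphere2) : y 0 ^ 2 + y 1 ^ 2 + y 2 ^ 2 = 1 := by
  have hy' : ‖y‖ = 1 := by simpa [Sphere2] using hy
  have := EuclideanSpace.real_norm_sq_eq y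
  rw [hy', Fin.sum_univ_three] at this
  linarith

lemma mk_sphere {a b c : ℝ} (h : a^2 + b^2 + c^2 = 1) : mkE3 a b c ∈ Sphere2 := by
  have := EuclideanSpace.real_norm_sq_eq (mkE3 a b c)
  rw [Fin.sum_univ_three] at this
  simp only [mkE3] at this
  simp at this
  have h2 : ‖mkE3 a b c‖^2 = 1 := by
    rw [← h, ← this]; rfl
  simp only [Sphere2, mem_sphere_iff_norm, sub_zero]
  nlinarith [norm_nonneg (mkE3 a b c)]

lemma Lfun_self (τ : ℝ) {x : E3} (hx : x ∈ Sphere2) : Lfun τ x x = 1 := by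
  have hx' : ‖x‖ = 1 := by simpa [Sphere2] using hx
  unfold Lfun Dfun
  rw [real_inner_self_eq_norm_sq, hx']
  norm_num

lemma fourpt {τ : ℝ} {ρ : Measure E3} (h : IsMinimizer τ ρ) {x z p y : E3}
    (hx : x ∈ msupport ρ) (hz : z ∈ msupport ρ) (hp : p ∈ msupport ρ) (hy : y ∈ msupport ρ)
    {a b : ℝ} (ha : 0 ≤ a) (hb : 0 ≤ b) (hab : a + b = 1) (hd : τ^2 * (1 - ⟪x, z⟫) ≤ 2)
    (hpy : Lfun τ p y = 0) :
    (a * Lfun τ x y + b * Lfun τ z y)^2 ≤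
      (1 + τ^2)/2 * ‖a • x + b • z - p‖^2 + τ^2/8 * (1 - ⟪x, z⟫)^2 := by
  have hsub := msupp_sphere h.2.2.1
  have := h.1
  have hxs := hsub hx
  have hzs := hsub hz
  have hps := hsub hp
  have hys := hsub hy
  set H := a * Lfun τ x y + b * Lfun τ z y with hH
  have hp4 : ∀ i : Fin 4, ![x, z, p, y] i ∈ msupport ρ := by
    intro i; fin_cases i <;> simpa
  have := psd_pts (kf_cont τ) (kf_nonneg τ) (kf_le τ) (kf_symm τ) h.2.2.1 (min_kf h)
    ![a, b, -1, -H] ![x, z, p, y] hp4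
  have s1 := kf_symm τ z x
  have s2 := kf_symm τ p x
  have s3 := kf_symm τ p z
  have s4 := kf_symm τ y x
  have s5 := kf_symm τ y z
  have s6 := kf_symm τ y p
  simp only [Fin.sum_univ_four, Matrix.cons_val] at this
  rw [s1, s2, s3, s4, s5, s6] at this
  simp only [kf_eq τ hxs hxs, kf_eq τ hxs hzs, kf_eq τ hxs hps, kf_eq τ hxs hys, kf_eq τ hzs hzs,
    kf_eq τ hzs hps, kf_eq τ hzs hys, kf_eq τ hps hps, kf_eq τ hps hys, kf_eq τ hys hys,
    Lfun_self τ hxs, Lfun_self τ hzs, Lfun_self τ hps, Lfun_self τ hys, hpy] at this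
  have hq : H^2 ≤ a^2 + b^2 + 1 + 2*a*b*Lfun τ x z - 2*a*Lfun τ x p - 2*b*Lfun τ z p := by
    nlinarith
  have hxz : Lfun τ x z = Dfun τ x z := by
    apply max_eq_right
    unfold Dfun
    have := (inner_bd hxs hzs).1
    exact mul_nonneg (by linarith) (by linarith)
  have hxp : Dfun τ x p ≤ Lfun τ x p := le_max_right _ _
  have hzp : Dfun τ z p ≤ Lfun τ z p := le_max_right _ _
  have hv : ‖a • x + b • z - p‖^2 = a^2 + b^2 + 1 + 2*a*b*⟪x,z⟫ - 2*a*⟪x,p⟫ - 2*b*⟪z,p⟫ := by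
    have hx' : ‖x‖ = 1 := by simpa [Sphere2] using hxs
    have hz' : ‖z‖ = 1 := by simpa [Sphere2] using hzs
    have hp' : ‖p‖ = 1 := by simpa [Sphere2] using hps
    rw [norm_sub_sq_real, norm_add_sq_real, inner_add_left, inner_smul_left, inner_smul_left,
      inner_smul_left, inner_smul_right, norm_smul, norm_smul, hx', hz', hp', mul_one, mul_one,
      Real.norm_eq_abs, Real.norm_eq_abs, sq_abs, sq_abs]
    simp
    ring
  rw [hxz] at hq
  have h1 := mul_le_mul_of_nonneg_left hxp ha
  have h2 := mul_le_mul_of_nonneg_left hzp hb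
  have hq2 : H^2 ≤ a^2 + b^2 + 1 + 2*a*b*Dfun τ x z - 2*a*Dfun τ x p - 2*b*Dfun τ z p := by
    linarith
  refine hq2.trans ?_
  rw [hv]
  unfold Dfun
  set u := ⟪x, z⟫
  set v := ⟪x, p⟫
  set w := ⟪z, p⟫
  obtain rfl : b = 1 - a := by linarith
  have e1 : 0 ≤ τ^2 * (1-u)^2 * (1 - 4 * (a*(1-a))) := by
    have : 1 - 4 * (a*(1-a)) = (1-2*a)^2 := by ring
    rw [this]; positivity
  have e2 : 0 ≤ a * τ^2 * (1-v)^2 := by positivity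
  have e3 : 0 ≤ (1-a) * τ^2 * (1-w)^2 := by positivity
  linarith

lemma taylor {δ : ℝ} (hδ : 0 < δ)
    (γ : ℝ → E3) (hsm : ∀ n : ℕ, ContDiffOn ℝ n γ (Set.Ioo (-δ) δ)) :
    ∃ C r : ℝ, 0 < C ∧ 0 < r ∧ ∀ t, |t| < r → ‖γ t - γ 0 - t • deriv γ 0‖ ≤ C * t^2 := by
  have hmem : Set.Ioo (-δ) δ ∈ nhds (0:ℝ) := Ioo_mem_nhds (by linarith) hδ
  have hd : ContDiffOn ℝ 1 (deriv γ) (Set.Ioo (-δ) δ) :=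
    (hsm 2).deriv_of_isOpen isOpen_Ioo (by norm_num)
  obtain ⟨K, s, hs, hK⟩ := (hd.contDiffAt hmem).exists_lipschitzOnWith
  obtain ⟨r, hr, hrs⟩ := Metric.mem_nhds_iff.1 (Filter.inter_mem hs hmem)
  refine ⟨K + 1, r, by positivity, hr, fun t ht => ?_⟩
  have hb : ∀ u ∈ Metric.closedBall (0:ℝ) |t|, u ∈ s ∧ u ∈ Set.Ioo (-δ) δ := by
    intro u hu
    have : u ∈ Metric.ball (0:ℝ) r := by
      rw [mem_closedBall_zero_iff, Real.norm_eq_abs] at hu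
      rw [mem_ball_zero_iff, Real.norm_eq_abs]; linarith
    exact hrs this
  have h0s : (0:ℝ) ∈ s := mem_of_mem_nhds hs
  have := (convex_closedBall (0:ℝ) |t|).norm_image_sub_le_of_norm_hasDerivWithin_le
    (f := fun u => γ u - u • deriv γ 0) (f' := fun u => deriv γ u - deriv γ 0)
    (C := K * |t|) (x := 0) (y := t)
    (fun u hu => by
      have hdiff : DifferentiableAt ℝ γ u :=
        ((hsm 1).differentiableOn (by norm_num)).differentiableAt
          (isOpen_Ioo.mem_nhds (hb u hu).2)
      have := hdiff.hasDerivAt.sub ((hasDerivAt_id u).smul_const (deriv γ 0))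
      rw [one_smul] at this
      exact this.hasDerivWithinAt)
    (fun u hu => by
      have h1 := hK.dist_le_mul u (hb u hu).1 0 h0s
      rw [dist_eq_norm, dist_eq_norm, sub_zero] at h1
      refine h1.trans (mul_le_mul_of_nonneg_left ?_ K.2)
      simpa using hu)
    (by simp) (by simp)
  simp only [zero_smul, sub_zero, Real.norm_eq_abs] at this
  have e : γ t - t • deriv γ 0 - γ 0 = γ t - γ 0 - t • deriv γ 0 := by abel
  rw [e] at this
  refine this.trans ?_
  rw [mul_assoc, ← sq, sq_abs]
  nlinarith [sq_nonneg t]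

lemma small_ev (A B : ℝ) (hB : 0 < B) : ∀ᶠ e in nhdsWithin (0:ℝ) (Set.Ioi 0), A * e < B := by
  have : Filter.Tendsto (fun e : ℝ => A * e) (nhdsWithin (0:ℝ) (Set.Ioi 0)) (nhds (A * 0)) :=
    ((continuous_const.mul continuous_id).tendsto 0).mono_left nhdsWithin_le_nhds
  rw [mul_zero] at this
  exact this.eventually_lt_const hB

lemma L_lower {τ C t : ℝ} (hτ : 6 < τ^2) {x y : E3} (hy : y ∈ Sphere2)
    (hy0 : y 0 = 1 - 2/τ^2)
    (hT : ‖x - mkE3 1 0 0 - t • mkE3 0 1 0‖ ≤ C * t^2) (hty : t * y 1 = |t| * |y 1|)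
    (hC : C * |t| ≤ |y 1| / 2) : |t| * |y 1| / 8 ≤ Lfun τ x y := by
  refine le_trans ?_ (le_max_right _ _)
  have hy' : ‖y‖ = 1 := by simpa [Sphere2] using hy
  have h1 := abs_real_inner_le_norm (x - mkE3 1 0 0 - t • mkE3 0 1 0) y
  rw [hy', mul_one, inner_sub_left, inner_sub_left, inner_smul_left, inner_mk, inner_mk] at h1
  simp only [conj_trivial, one_mul, zero_mul, add_zero, zero_add] at h1
  have h2 := (abs_le.1 (h1.trans hT)).1
  rw [hty] at h2
  have h3 : C * t^2 ≤ |t| * (|y 1| / 2) := by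
    rw [← sq_abs t]
    have := mul_le_mul_of_nonneg_left hC (abs_nonneg t)
    nlinarith
  set w := |t| * |y 1| with hw
  have hw0 : 0 ≤ w := by positivity
  have h4 : w / 2 ≤ ⟪x, y⟫ - y 0 := by linarith
  have h5 : 2 / τ^2 ≤ 1 := by rw [div_le_one (by linarith)]; linarith
  unfold Dfun
  set u := ⟪x, y⟫
  have h6 : 2 - τ^2 * (1 - u) = τ^2 * (u - y 0) := by
    have ht0 : τ ≠ 0 := by rintro rfl; norm_num at hτ
    rw [hy0]; field_simp; ring
  rw [h6]
  have hu : 0 ≤ u := by linarith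
  have h7 : w / 2 ≤ τ^2 * (u - y 0) := by nlinarith
  nlinarith

set_option maxHeartbeats 1000000 in
lemma no_kink {τ β δ : ℝ} (hτ : 6 < τ^2) (hβ : β < 1 / 6)
    {ρ : Measure E3} (hmin : IsMinimizer τ ρ) (hδ : 0 < δ)
    (γ : ℝ → E3) (hsm : ∀ n : ℕ, ContDiffOn ℝ n γ (Set.Ioo (-δ) δ))
    (h0 : γ 0 = mkE3 1 0 0) (h1 : deriv γ 0 = mkE3 0 1 0)
    (hacc : UniformTwoSidedAcc (msupport ρ) β δ γ) (hp : mkE3 1 0 0 ∈ msupport ρ)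
    {y : E3} (hy : y ∈ msupport ρ) (hy0 : y 0 = 1 - 2/τ^2) : y 1 = 0 := by
  by_contra hne
  have hsub := msupp_sphere hmin.2.2.1
  have hys := hsub hy
  obtain ⟨C, r, hC, hr, hT⟩ := taylor hδ γ hsm
  rw [h0, h1] at hT
  obtain ⟨ε₀, hε₀, hεδ, hA⟩ := hacc
  have hY : 0 < |y 1| := abs_pos.2 hne
  set K := (1+τ^2)/2 * C^2 + τ^2/8 * (2*(1+C)^2)^2 with hK
  obtain ⟨ε, ⟨⟨⟨⟨⟨c1, c2⟩, c3⟩, c4⟩, c5⟩, c6⟩, hε⟩ :=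
    ((((((small_ev 1 ε₀ hε₀).and (small_ev 1 r hr)).and (small_ev 1 1 one_pos)).and
      (small_ev C (|y 1|/2) (by positivity))).and (small_ev (τ^2*(1+C)^2) 1 one_pos)).and
      (small_ev (256 * K) (|y 1|^2) (by positivity))).and self_mem_nhdsWithin |>.exists
  rw [one_mul] at c1 c2 c3
  replace hε : 0 < ε := hε
  obtain ⟨⟨t', ht', hM'⟩, ⟨t, ht, hM⟩⟩ := hA ε hε c1.le
  obtain ⟨s, rfl⟩ : ∃ s, t' = -s := ⟨-t', by ring⟩
  have hs1 : ε^(1+β) < s := by have := ht'.2; linarith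
  have hs2 : s < ε := by have := ht'.1; linarith
  have ht1 := ht.1
  have ht2 := ht.2
  have hpow : 0 < ε^(1+β) := Real.rpow_pos_of_pos hε _
  have hs0 : 0 < s := hpow.trans hs1
  have ht0 : 0 < t := hpow.trans ht1
  have hTt := hT t (by rw [abs_of_pos ht0]; linarith)
  have hTs := hT (-s) (by rw [abs_neg, abs_of_pos hs0]; linarith)
  set P := mkE3 1 0 0 with hP
  set e := mkE3 0 1 0 with he
  set a := s/(s+t) with ha
  set b := t/(s+t) with hb
  have hst : 0 < s + t := by linarith
  have ha0 : 0 ≤ a := by positivity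
  have hb0 : 0 ≤ b := by positivity
  have hab : a + b = 1 := by rw [ha, hb]; field_simp
  have hTt' : ‖γ t - P - t • e‖ ≤ C * ε^2 := hTt.trans (by gcongr)
  have hTs' : ‖γ (-s) - P - (-s) • e‖ ≤ C * ε^2 := hTs.trans (by rw [neg_sq]; gcongr)
  have hv : ‖a • γ t + b • γ (-s) - P‖ ≤ C * ε^2 := by
    have hz : a * t - b * s = 0 := by rw [ha, hb]; field_simp; ring
    have : a • γ t + b • γ (-s) - P = a • (γ t - P - t • e) + b • (γ (-s) - P - (-s) • e) := by
      have e1 : a • (γ t - P - t • e) + b • (γ (-s) - P - (-s) • e)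
        = a • γ t + b • γ (-s) - (a + b) • P - (a * t - b * s) • e := by module
      rw [e1, hab, hz]; simp
    rw [this]
    calc _ ≤ ‖a • (γ t - P - t • e)‖ + ‖b • (γ (-s) - P - (-s) • e)‖ := norm_add_le _ _
      _ = a * ‖γ t - P - t • e‖ + b * ‖γ (-s) - P - (-s) • e‖ := by
        rw [norm_smul, norm_smul, Real.norm_of_nonneg ha0, Real.norm_of_nonneg hb0]
      _ ≤ a * (C*ε^2) + b * (C * ε^2) := by gcongr
      _ = C * ε^2 := by rw [← add_mul, hab, one_mul]
  have hes : ‖e‖ = 1 := by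
    have : e ∈ Sphere2 := mk_sphere (by norm_num)
    simpa [Sphere2] using this
  have hxz : ‖γ t - γ (-s)‖ ≤ 2 * (1 + C) * ε := by
    have : γ t - γ (-s) = (γ t - P - t • e) - (γ (-s) - P - (-s) • e) + (t + s) • e := by module
    rw [this]
    calc _ ≤ ‖γ t - P - t • e‖ + ‖γ (-s) - P - (-s) • e‖ + ‖(t+s) • e‖ :=
          (norm_add_le _ _).trans (by gcongr; exact norm_sub_le _ _)
      _ ≤ C*ε^2 + C*ε^2 + (t + s) := by
          rw [norm_smul, hes, mul_one, Real.norm_of_nonneg (by linarith)]; gcongr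
      _ ≤ 2 * (1 + C) * ε := by
          have k1 : C * ε^2 ≤ C * ε :=
            mul_le_mul_of_nonneg_left (by rw [sq]; exact mul_le_of_le_one_left hε.le c3.le) hC.le
          linarith
  have hd : 1 - ⟪γ t, γ (-s)⟫ ≤ 2 * (1+C)^2 * ε^2 := by
    have hx' : ‖γ t‖ = 1 := by simpa [Sphere2] using hsub hM
    have hz' : ‖γ (-s)‖ = 1 := by simpa [Sphere2] using hsub hM'
    have := norm_sub_sq_real (γ t) (γ (-s))
    rw [hx', hz'] at this
    have h3 : ‖γ t - γ (-s)‖^2 ≤ (2 * (1 + C) * ε)^2 := by gcongr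
    have h4 : (2 * (1 + C) * ε)^2 = 2 * (2 * (1+C)^2 * ε^2) := by ring
    linarith
  have hd0 : 0 ≤ 1 - ⟪γ t, γ (-s)⟫ := by linarith [(inner_bd (hsub hM) (hsub hM')).2]
  have hpy : Lfun τ P y = 0 := by
    apply max_eq_left
    unfold Dfun
    rw [hP, inner_mk, hy0]
    have : 2 - τ ^ 2 * (1 - (1 * (1 - 2 / τ ^ 2) + 0 * y 1 + 0 * y 2)) = 0 := by
      have ht0 : τ ≠ 0 := by rintro rfl; norm_num at hτ
      field_simp; ring
    rw [this, mul_zero]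
  have hfour := fourpt hmin hM hM' hp hy ha0 hb0 hab (by
    calc τ^2 * (1 - ⟪γ t, γ (-s)⟫) ≤ τ^2 * (2 * (1+C)^2 * ε^2) := by gcongr
      _ = 2 * (τ^2 * (1+C)^2 * ε) * ε := by ring
      _ ≤ 2 * 1 * 1 := by gcongr
      _ = 2 := by ring) hpy
  have hrhs : (1 + τ^2)/2 * ‖a • γ t + b • γ (-s) - P‖^2 + τ^2/8 * (1 - ⟪γ t, γ (-s)⟫)^2
      ≤ K * ε^4 := by
    calc _ ≤ (1 + τ^2)/2 * (C * ε^2)^2 + τ^2/8 * (2 * (1+C)^2 * ε^2)^2 := by gcongr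
      _ = K * ε^4 := by rw [hK]; ring
  have hlow : ε^(1+β) / 2 * |y 1| / 8 ≤ a * Lfun τ (γ t) y + b * Lfun τ (γ (-s)) y := by
    have hL1 : 0 ≤ Lfun τ (γ t) y := le_max_left _ _
    have hL2 : 0 ≤ Lfun τ (γ (-s)) y := le_max_left _ _
    have hmid : ε^(1+β) / 2 ≤ s * t / (s + t) := by
      rw [div_le_div_iff₀ two_pos hst]
      have k1 := mul_le_mul_of_nonneg_right hs1.le ht0.le
      have k2 := mul_le_mul_of_nonneg_left ht1.le hs0.le
      linarith
    have hmid2 : ε^(1+β) / 2 * |y 1| / 8 ≤ s * t / (s + t) * |y 1| / 8 := by gcongr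
    refine hmid2.trans ?_
    rcases lt_or_gt_of_ne hne with hlt | hgt
    · have := L_lower hτ hys hy0 hTs (by
        rw [abs_neg, abs_of_pos hs0, abs_of_neg hlt]; ring) (by
        rw [abs_neg, abs_of_pos hs0]; exact (mul_le_mul_of_nonneg_left hs2.le hC.le).trans c4.le)
      rw [abs_neg, abs_of_pos hs0] at this
      have h3 := mul_le_mul_of_nonneg_left this hb0
      have e3 : b * (s * |y 1| / 8) = s * t / (s + t) * |y 1| / 8 := by rw [hb]; ring
      linarith [mul_nonneg ha0 hL1]
    · have := L_lower hτ hys hy0 hTt (by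
        rw [abs_of_pos ht0, abs_of_pos hgt]) (by
        rw [abs_of_pos ht0]; exact (mul_le_mul_of_nonneg_left ht2.le hC.le).trans c4.le)
      rw [abs_of_pos ht0] at this
      have h3 := mul_le_mul_of_nonneg_left this ha0
      have e3 : a * (t * |y 1| / 8) = s * t / (s + t) * |y 1| / 8 := by rw [ha]; ring
      linarith [mul_nonneg hb0 hL2]
  have hpw : ε^3 ≤ (ε^(1+β))^2 := by
    rw [← Real.rpow_natCast, ← Real.rpow_natCast, ← Real.rpow_mul hε.le]
    apply Real.rpow_le_rpow_of_exponent_ge hε c3.le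
    push_cast; linarith
  have hsq : (ε^(1+β) / 2 * |y 1| / 8)^2 ≤ K * ε^4 := by
    refine le_trans ?_ (hfour.trans hrhs)
    gcongr
  have h9 : ε^3 * |y 1|^2 ≤ ε^3 * (256 * K * ε) := by
    calc ε^3 * |y 1|^2 ≤ (ε^(1+β))^2 * |y 1|^2 := by gcongr
      _ = 256 * (ε^(1+β) / 2 * |y 1| / 8)^2 := by ring
      _ ≤ 256 * (K * ε^4) := by gcongr
      _ = _ := by ring
  have := le_of_mul_le_mul_left h9 (by positivity)
  linarith

lemma ext3 {x y : E3} (h0 : x 0 = y 0) (h1 : x 1 = y 1) (h2 : x 2 = y 2) : x = y := by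
  ext i; fin_cases i <;> assumption

lemma mk0 (a b c : ℝ) : mkE3 a b c 0 = a := rfl
lemma mk1 (a b c : ℝ) : mkE3 a b c 1 = b := rfl
lemma mk2 (a b c : ℝ) : mkE3 a b c 2 = c := rfl

lemma second_diff {τ s : ℝ} (hτ : 6 < τ^2) (hs : 0 < Real.sin s) {y : E3} (hy : y ∈ Sphere2)
    (hy0 : 1 - 2/τ^2 < y 0) :
    Dfun τ (mkE3 (Real.cos s) (Real.sin s) 0) y + Dfun τ (mkE3 (Real.cos s) (-Real.sin s) 0) y
      - 2 * Dfun τ (mkE3 1 0 0) y < 0 := by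
  unfold Dfun
  simp only [inner_mk]
  have h1 := sph_coord hy
  have h2 := Real.sin_sq_add_cos_sq s
  have hc := Real.cos_le_one s
  set c := Real.cos s
  set σ := Real.sin s
  set u := y 0
  set v := y 1
  have hT : 2 < τ^2 * (u * 0 + 1) := by linarith
  have hu : τ^2 - 2 < τ^2 * u := by
    have ht0 : τ ≠ 0 := by rintro rfl; norm_num at hτ
    have : τ^2 * (1 - 2/τ^2) = τ^2 - 2 := by field_simp
    rw [← this]; exact mul_lt_mul_of_pos_left hy0 (by linarith)
  have hu0 : 2/3 < u := by
    have : 2/τ^2 < 1/3 := by rw [div_lt_div_iff₀ (by linarith) (by norm_num)]; linarith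
    linarith
  have hv : v^2 ≤ 1 - u^2 := by nlinarith [sq_nonneg (y 2)]
  -- the quadratic is negative
  have hneg : τ^2 - u - 2*τ^2*u^2 < 0 := by
    nlinarith [mul_pos (sub_pos.2 hu) (sub_pos.2 hu0)]
  have hcc : σ^2 / 2 ≤ 1 - c := by nlinarith [sq_nonneg (1-c)]
  have e : 1 / 4 * (1 + (c * u + σ * v + 0 * y 2)) * (2 - τ ^ 2 * (1 - (c * u + σ * v + 0 * y 2))) +
        1 / 4 * (1 + (c * u + -σ * v + 0 * y 2)) * (2 - τ ^ 2 * (1 - (c * u + -σ * v + 0 * y 2))) -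
      2 * (1 / 4 * (1 + (1 * u + 0 * v + 0 * y 2)) * (2 - τ ^ 2 * (1 - (1 * u + 0 * v + 0 * y 2))))
      = 1/4 * (-4 * u * (1 - c) + 2 * τ^2 * σ^2 * (v^2 - u^2)) := by
    have hc2 : c^2 = 1 - σ^2 := by linarith
    ring_nf
    rw [hc2]; ring
  rw [e]
  have h5 : u * (σ^2/2) ≤ u * (1 - c) := mul_le_mul_of_nonneg_left hcc (by linarith)
  have h6 : (τ^2 * σ^2) * (v^2 - u^2) ≤ (τ^2 * σ^2) * (1 - 2 * u^2) :=
    mul_le_mul_of_nonneg_left (by linarith) (by positivity)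
  have h7 : σ^2 * (τ^2 - u - 2*τ^2*u^2) < 0 := mul_neg_of_pos_of_neg (by positivity) hneg
  nlinarith

lemma close_aux {s η a b : ℝ} (hs0 : 0 < s) (hs1 : s < 1) (hsη : 2 * s < η) (hsp : 0 < Real.sin s)
    (ha : |a| ≤ 1) (hb : |b| ≤ 1) : |Real.cos s * a + Real.sin s * b - a| < η := by
  have hsl : Real.sin s ≤ s := Real.sin_le hs0.le
  have hcl : 1 - s^2/2 ≤ Real.cos s := Real.one_sub_sq_div_two_le_cos
  have hc := Real.cos_le_one s
  have h1 : |Real.sin s * b| ≤ s := by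
    rw [abs_mul, abs_of_pos hsp]
    exact (mul_le_of_le_one_right hsp.le hb).trans hsl
  have h2 : |(Real.cos s - 1) * a| ≤ s^2/2 := by
    rw [abs_mul, abs_of_nonpos (by linarith)]
    exact (mul_le_of_le_one_right (by linarith) ha).trans (by linarith)
  have e : Real.cos s * a + Real.sin s * b - a = (Real.cos s - 1) * a + Real.sin s * b := by ring
  rw [e]
  have h3 := abs_add_le ((Real.cos s - 1) * a) (Real.sin s * b)
  have h4 : s^2 ≤ s := by nlinarith
  linarith

set_option maxHeartbeats 1000000 in
/-- Lemma 7.2: under the assumptions of Proposition 7.1, at least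
one of `q₁`, `q₂` is an accumulation point of `M`. -/
theorem stmt_12 (τ β δ : ℝ) (hτ : Real.sqrt 6 < τ) (hβ0 : 0 < β) (hβ : β < 1 / 6)
    (ρ : Measure E3) (hmin : IsMinimizer τ ρ) (hδ : 0 < δ)
    (γ : ℝ → E3) (hsm : ∀ n : ℕ, ContDiffOn ℝ n γ (Set.Ioo (-δ) δ))
    (hmap : ∀ t ∈ Set.Ioo (-δ) δ, γ t ∈ Sphere2)
    (harc : ∀ t ∈ Set.Ioo (-δ) δ, ‖deriv γ t‖ = 1)
    (h0 : γ 0 = mkE3 1 0 0) (h1 : deriv γ 0 = mkE3 0 1 0)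
    (hacc : UniformTwoSidedAcc (msupport ρ) β δ γ) :
    AccumulationPt (q1pt τ) (msupport ρ) ∨ AccumulationPt (q2pt τ) (msupport ρ) := by
  have hτ0 : 0 < τ := (Real.sqrt_nonneg 6).trans_lt hτ
  have hτ2 : 6 < τ^2 := (Real.sqrt_lt' hτ0).1 hτ
  have := hmin.1
  have hsub := msupp_sphere hmin.2.2.1
  set M := msupport ρ with hM
  have hMc : IsClosed M := msupp_closed ρ
  -- p is in the support
  have hp : mkE3 1 0 0 ∈ M := by
    rw [← h0, ← hMc.closure_eq, Metric.mem_closure_iff]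
    intro ε hε
    have hcont : ContinuousAt γ 0 := (hsm 1).continuousOn.continuousAt
      (Ioo_mem_nhds (by linarith) hδ)
    obtain ⟨d, hd, hdd⟩ := Metric.continuousAt_iff.1 hcont ε hε
    obtain ⟨ε₀, hε₀, -, hA⟩ := hacc
    have hm : 0 < min ε₀ d := lt_min hε₀ hd
    obtain ⟨-, t, ht, htM⟩ := hA (min ε₀ d) hm (min_le_left _ _)
    refine ⟨γ t, htM, ?_⟩
    rw [dist_comm]
    apply hdd
    have ht0 : 0 < t := (Real.rpow_pos_of_pos hm _).trans ht.1
    rw [Real.dist_eq, sub_zero, abs_of_pos ht0]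
    exact ht.2.trans_le (min_le_right _ _)
  have hps : mkE3 1 0 0 ∈ Sphere2 := hsub hp
  set c := 1 - 2/τ^2 with hc
  have hc0 : 2/3 < c := by
    have : 2/τ^2 < 1/3 := by rw [div_lt_div_iff₀ (by linarith) (by norm_num)]; linarith
    linarith
  have hc1 : c < 1 := by
    have : 0 < 2/τ^2 := by positivity
    linarith
  have hcos : Real.cos (θmax τ) = c := Real.cos_arccos (by linarith) hc1.le
  have hsin : Real.sin (θmax τ)^2 = 1 - c^2 := by
    have := Real.sin_sq_add_cos_sq (θmax τ)
    rw [hcos] at this; linarith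
  by_contra hcon
  push Not at hcon
  obtain ⟨hq1, hq2⟩ := hcon
  simp only [AccumulationPt, not_forall, not_exists, not_and, not_not] at hq1 hq2
  obtain ⟨U1, hU1, hq1⟩ := hq1
  obtain ⟨U2, hU2, hq2⟩ := hq2
  have hK : ∀ y ∈ M, y 0 = c → y = q1pt τ ∨ y = q2pt τ := by
    intro y hy hy0
    have hy1 : y 1 = 0 := no_kink hτ2 hβ hmin hδ γ hsm h0 h1 hacc hp hy hy0
    have h2 := sph_coord (hsub hy)
    rw [hy0, hy1] at h2
    have : y 2 ^ 2 = Real.sin (θmax τ)^2 := by rw [hsin]; linarith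
    rcases sq_eq_sq_iff_eq_or_eq_neg.1 this with h | h
    · left; exact ext3 (by rw [hy0, q1pt, mk0, hcos]) (by rw [hy1, q1pt, mk1]) (by rw [h, q1pt, mk2])
    · right; exact ext3 (by rw [hy0, q2pt, mk0, hcos]) (by rw [hy1, q2pt, mk1]) (by rw [h, q2pt, mk2])
  obtain ⟨η, hη, hgap⟩ : ∃ η : ℝ, 0 < η ∧ ∀ y ∈ M, y = q1pt τ ∨ y = q2pt τ ∨ η ≤ |y 0 - c| := by
    set N := M \ (interior U1 ∪ interior U2) with hN
    have hNc : IsCompact N := by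
      have h1 : IsClosed N := hMc.sdiff (isOpen_interior.union isOpen_interior)
      have h2 : IsCompact Sphere2 := by unfold Sphere2; exact isCompact_sphere _ _
      exact h2.of_isClosed_subset h1 (sdiff_subset.trans hsub)
    have hcontN : ContinuousOn (fun y : E3 => |y 0 - c|) N := by fun_prop
    have hposN : ∀ y ∈ N, 0 < |y 0 - c| := by
      intro y hy
      rw [abs_pos, sub_ne_zero]
      intro h
      apply hy.2
      rcases hK y hy.1 h with rfl | rfl
      · left; exact mem_interior_iff_mem_nhds.2 hU1
      · right; exact mem_interior_iff_mem_nhds.2 hU2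
    obtain ⟨η, hη, hle⟩ := hNc.exists_forall_le' hcontN hposN
    refine ⟨η, hη, fun y hy => ?_⟩
    by_cases hyN : y ∈ N
    · exact Or.inr (Or.inr (hle y hyN))
    · have : y ∈ interior U1 ∪ interior U2 := by
        by_contra h; exact hyN ⟨hy, h⟩
      rcases this with h | h
      · left; exact hq1 y hy (interior_subset h)
      · right; left; exact hq2 y hy (interior_subset h)
  obtain ⟨s, hs0, hs1, hsη⟩ : ∃ s : ℝ, 0 < s ∧ s < 1 ∧ 2 * s < η := by
    refine ⟨min (1/2) (η/3), lt_min (by norm_num) (by linarith), ?_, ?_⟩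
    · exact (min_le_left _ _).trans_lt (by norm_num)
    · have := min_le_right (1/2) (η/3); linarith
  have hsp : 0 < Real.sin s := Real.sin_pos_of_pos_of_lt_pi hs0 (by linarith [Real.pi_gt_three])
  have hsl : Real.sin s ≤ s := Real.sin_le hs0.le
  have hcl : 1 - s^2/2 ≤ Real.cos s := Real.one_sub_sq_div_two_le_cos
  have hcp : 0 < Real.cos s := by nlinarith
  have hcq : Real.cos s < 1 := by
    nlinarith [Real.sin_sq_add_cos_sq s, Real.cos_le_one s]
  set X := mkE3 (Real.cos s) (Real.sin s) 0 with hX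
  set Z := mkE3 (Real.cos s) (-Real.sin s) 0 with hZ
  set P := mkE3 1 0 0 with hP
  have hsc := Real.sin_sq_add_cos_sq s
  have hXs : X ∈ Sphere2 := mk_sphere (by linarith)
  have hZs : Z ∈ Sphere2 := mk_sphere (by rw [neg_sq]; linarith)
  have hid : ∀ w u, 2 - τ^2 * (1 - u) = τ^2 * (u - c) + 0 * w := by
    intro w u; rw [hc]; field_simp; ring
  have hLz : ∀ x y : E3, x ∈ Sphere2 → y ∈ Sphere2 → ⟪x, y⟫ ≤ c → Lfun τ x y = 0 := by
    intro x y hx hy h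
    apply max_eq_left
    unfold Dfun
    rw [hid 0]
    have := (inner_bd hx hy).1
    have h2 : τ^2 * (⟪x, y⟫ - c) ≤ 0 := mul_nonpos_of_nonneg_of_nonpos (sq_nonneg _) (by linarith)
    exact mul_nonpos_of_nonneg_of_nonpos (by linarith) (by linarith)
  have hLp : ∀ x y : E3, x ∈ Sphere2 → y ∈ Sphere2 → c ≤ ⟪x, y⟫ → Lfun τ x y = Dfun τ x y := by
    intro x y hx hy h
    apply max_eq_right
    unfold Dfun
    rw [hid 0]
    have := (inner_bd hx hy).1
    have h2 : 0 ≤ τ^2 * (⟪x, y⟫ - c) := mul_nonneg (sq_nonneg _) (by linarith)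
    exact mul_nonneg (by linarith) (by linarith)
  have hclose : ∀ y ∈ Sphere2, |⟪X, y⟫ - y 0| < η ∧ |⟪Z, y⟫ - y 0| < η ∧ ⟪P, y⟫ = y 0 := by
    intro y hy
    have hy3 := sph_coord hy
    have a0 : |y 0| ≤ 1 := by
      rw [← sq_le_one_iff_abs_le_one]; nlinarith [sq_nonneg (y 1), sq_nonneg (y 2)]
    have a1 : |y 1| ≤ 1 := by
      rw [← sq_le_one_iff_abs_le_one]; nlinarith [sq_nonneg (y 0), sq_nonneg (y 2)]
    rw [hX, hZ, hP, inner_mk, inner_mk, inner_mk, zero_mul, add_zero, add_zero]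
    refine ⟨close_aux hs0 hs1 hsη hsp a0 a1, ?_, by ring⟩
    rw [neg_mul, ← mul_neg]
    exact close_aux hs0 hs1 hsη hsp a0 (by rwa [abs_neg])
  have hphi : ∀ y ∈ M, kf τ X y + kf τ Z y - 2 * kf τ P y ≤ 0 ∧
      (c < y 0 → kf τ X y + kf τ Z y - 2 * kf τ P y < 0) := by
    intro y hy
    have hys := hsub hy
    rw [kf_eq τ hXs hys, kf_eq τ hZs hys, kf_eq τ hps hys]
    obtain ⟨g1, g2, g3⟩ := hclose y hys
    have hq : ∀ z : ℝ, y = mkE3 c 0 z → Lfun τ X y + Lfun τ Z y - 2 * Lfun τ P y ≤ 0 ∧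
      (c < y 0 → Lfun τ X y + Lfun τ Z y - 2 * Lfun τ P y < 0) := by
      intro z hz
      have e0 : y 0 = c := by rw [hz, mk0]
      have e1 : y 1 = 0 := by rw [hz, mk1]
      rw [hLz X y hXs hys, hLz Z y hZs hys, hLz P y hps hys]
      · refine ⟨by norm_num, fun h => by linarith⟩
      · rw [g3, e0]
      · rw [hZ, inner_mk, e0, e1]; nlinarith
      · rw [hX, inner_mk, e0, e1]; nlinarith
    rcases hgap y hy with h | h | h
    · exact hq _ (by rw [h, q1pt, hcos])
    · exact hq _ (by rw [h, q2pt, hcos])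
    · obtain ⟨g1, g1'⟩ := abs_lt.1 g1
      obtain ⟨g2, g2'⟩ := abs_lt.1 g2
      rcases le_abs.1 h with h | h
      · rw [hLp X y hXs hys (by linarith), hLp Z y hZs hys (by linarith),
          hLp P y hps hys (by linarith)]
        have := second_diff hτ2 hsp hys (show 1 - 2/τ^2 < y 0 by linarith)
        exact ⟨this.le, fun _ => this⟩
      · rw [hLz X y hXs hys (by linarith), hLz Z y hZs hys (by linarith),
          hLz P y hps hys (by linarith)]
        refine ⟨by norm_num, fun h => by linarith⟩
  have hmk := min_kf hmin
  have hik : ∀ x, Integrable (kf τ x) ρ := int_k (kf_cont τ) (kf_nonneg τ) (kf_le τ)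
  have E1 := EL1 (kf_cont τ) (kf_nonneg τ) (kf_le τ) (kf_symm τ) hmin.2.2.1 hmk X hXs
  have E2 := EL1 (kf_cont τ) (kf_nonneg τ) (kf_le τ) (kf_symm τ) hmin.2.2.1 hmk Z hZs
  have E3' := EL2 (kf_cont τ) (kf_nonneg τ) (kf_le τ) (kf_symm τ) hmin.2.2.1 hmk P hp
  have hint : ∫ y, (2 * kf τ P y - (kf τ X y + kf τ Z y)) ∂ρ ≤ 0 := by
    have hXZ : Integrable (fun y => kf τ X y + kf τ Z y) ρ := (hik X).add (hik Z)
    rw [integral_sub ((hik P).const_mul 2) hXZ, integral_const_mul,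
      integral_add (hik X) (hik Z)]
    linarith
  have hMae := msupp_ae ρ
  have hnn : 0 ≤ᵐ[ρ] fun y => 2 * kf τ P y - (kf τ X y + kf τ Z y) := by
    filter_upwards [hMae] with y hy
    have := (hphi y hy).1
    simp only [Pi.zero_apply]; linarith
  have hzero := (integral_eq_zero_iff_of_nonneg_ae hnn
    (((hik P).const_mul 2).sub ((hik X).add (hik Z)))).1 
    (le_antisymm hint (integral_nonneg_of_ae hnn))
  have hnull : ∀ᵐ y ∂ρ, ¬ (c < y 0) := by
    filter_upwards [hMae, hzero] with y hy hy2 hlt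
    have := (hphi y hy).2 hlt
    simp only [Pi.zero_apply] at hy2; linarith
  have hopen : IsOpen {y : E3 | c < y 0} := isOpen_lt continuous_const (by fun_prop)
  have hpos := hp _ hopen (show c < P 0 by rw [hP, mk0]; exact hc1)
  rw [ae_iff] at hnull
  simp only [not_not] at hnull
  exact hpos.ne' hnull
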